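/- Let q be a prime power, let d be a positive divisor of q − 1, and let a, b ∈ 𝔽_q[t] be monic, nonzero, and relatively prime. Then the d-th power residue symbols satisfy (a/b)_d = (b/a)_d · (−1)^{((q−1)/d) · deg(a) · deg(b)}, where −1 is the element of 𝔽_q^×. -/

import Mathlib

open Polynomial
open scoped Classical

/-- The `d`-th power residue symbol `(a/P)_d` at a prime (irreducible) polynomial `P`:
the unique `c ∈ 𝔽_q^×` with `a^((|P|-1)/d) ≡ c (mod P)`; junk value `1` if no such
`c` exists. -/
noncomputable def primeResSymbol {F : Type} [Field F] [Fintype F] (d : ℕ)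
    (P a : Polynomial F) : Fˣ :=
  if h : ∃ c : Fˣ, Ideal.Quotient.mk (Ideal.span {P}) (Polynomial.C (c : F)) =
      Ideal.Quotient.mk (Ideal.span {P}) a ^ ((Fintype.card F ^ P.natDegree - 1) / d)
  then h.choose else 1

/-- The `d`-th power residue symbol `(a/b)_d`, extended multiplicatively over the
prime factorization of `b`. -/
noncomputable def resSymbol {F : Type} [Field F] [Fintype F] (d : ℕ)
    (a b : Polynomial F) : Fˣ :=
  ((UniqueFactorizationMonoid.factors b).map (fun P => primeResSymbol d P a)).prod

/-- The norm of the class of `g` in `K[X]/(f)` is the resultant of `f` and `g`. -/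
theorem AdjoinRoot.norm_mk_eq_resultant {K : Type*} [Field K] [PerfectField K]
    {f : K[X]} (hf : f.Monic) (hirr : Irreducible f) (g : K[X]) :
    Algebra.norm K (AdjoinRoot.mk f g) = resultant f g := by
  have : Fact (Irreducible f) := ⟨hirr⟩
  have : FiniteDimensional K (AdjoinRoot f) := (AdjoinRoot.powerBasis hirr.ne_zero).finite
  let E := AlgebraicClosure K
  have hsep : f.Separable := PerfectField.separable_of_irreducible hirr
  apply (algebraMap K E).injective
  rw [Algebra.norm_eq_prod_embeddings K E, ← resultant_map_map]
  have hmonic : (f.map (algebraMap K E)).Monic := hf.map _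
  have h := resultant_eq_prod_eval (f.map (algebraMap K E)) (g.map (algebraMap K E))
    g.natDegree natDegree_map_le (IsAlgClosed.splits _)
  rw [natDegree_map, hmonic.leadingCoeff, one_pow, one_mul] at h
  rw [h]
  have hnodup : (f.aroots E).Nodup := nodup_roots hsep.map
  have hroots (σ : AdjoinRoot f →ₐ[K] E) : σ (AdjoinRoot.root f) ∈ f.aroots E := by
    rw [mem_aroots]
    refine ⟨hirr.ne_zero, ?_⟩
    rw [aeval_algHom_apply, AdjoinRoot.aeval_eq, AdjoinRoot.mk_self, map_zero]
  have hval : (f.map (algebraMap K E)).roots = (f.aroots E).toFinset.val := by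
    rw [Multiset.toFinset_val, hnodup.dedup]
  rw [hval]
  change _ = ∏ x ∈ (f.aroots E).toFinset, eval x (g.map (algebraMap K E))
  refine Finset.prod_bij (fun σ _ => σ (AdjoinRoot.root f)) ?_ ?_ ?_ ?_
  · exact fun σ _ => Multiset.mem_toFinset.2 (hroots σ)
  · exact fun σ _ τ _ hστ => AdjoinRoot.algHom_ext hστ
  · intro x hx
    have hx' := (mem_aroots.1 (Multiset.mem_toFinset.1 hx)).2
    exact ⟨AdjoinRoot.liftAlgHom f (Algebra.ofId K E) x hx', Finset.mem_univ _,
      AdjoinRoot.liftAlgHom_root _ _ _ _⟩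
  · intro σ _
    rw [← AdjoinRoot.aeval_eq, ← aeval_algHom_apply, eval_map_algebraMap]

theorem primeResSymbol_eq_of_associated {F : Type} [Field F] [Fintype F] (d : ℕ)
    {P Q : F[X]} (h : Associated P Q) (a : F[X]) :
    primeResSymbol d P a = primeResSymbol d Q a := by
  have hspan := Ideal.span_singleton_eq_span_singleton.2 h
  have hdeg := natDegree_eq_of_degree_eq (degree_eq_degree_of_associated h)
  simp only [primeResSymbol, ← map_pow, Ideal.Quotient.eq, hspan, hdeg]

theorem coe_primeResSymbol {F : Type} [Field F] [Fintype F] {d : ℕ}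
    (hdvd : d ∣ Fintype.card F - 1) {P a : F[X]} (hP : P.Monic) (hirr : Irreducible P)
    (hPa : IsCoprime P a) :
    (primeResSymbol d P a : F) = resultant P a ^ ((Fintype.card F - 1) / d) := by
  have : Fact (Irreducible P) := ⟨hirr⟩
  have : Module.Finite F (AdjoinRoot P) := (AdjoinRoot.powerBasis hirr.ne_zero).finite
  have : Finite (AdjoinRoot P) := Module.finite_of_finite F
  have hcard : Nat.card (AdjoinRoot P) = Fintype.card F ^ P.natDegree := by
    rw [Module.natCard_eq_pow_finrank (K := F), Nat.card_eq_fintype_card,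
      (AdjoinRoot.powerBasis hirr.ne_zero).finrank, AdjoinRoot.powerBasis_dim]
  have hres : resultant P a ≠ 0 := resultant_ne_zero P a hPa
  have hexp : (Fintype.card F ^ P.natDegree - 1) / d =
      (Fintype.card F ^ P.natDegree - 1) / (Fintype.card F - 1) *
        ((Fintype.card F - 1) / d) :=
    (Nat.div_mul_div (by simpa using Nat.sub_dvd_pow_sub_pow (Fintype.card F) 1 P.natDegree)
      hdvd).symm
  have hkey : AdjoinRoot.of P (resultant P a ^ ((Fintype.card F - 1) / d)) =
      AdjoinRoot.mk P a ^ ((Fintype.card F ^ P.natDegree - 1) / d) := by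
    rw [hexp, pow_mul, map_pow, ← hcard, ← Nat.card_eq_fintype_card,
      ← FiniteField.algebraMap_norm_eq_pow, AdjoinRoot.norm_mk_eq_resultant hP hirr,
      AdjoinRoot.algebraMap_eq]
  have hex : ∃ c : Fˣ, Ideal.Quotient.mk (Ideal.span {P}) (C (c : F)) =
      Ideal.Quotient.mk (Ideal.span {P}) a ^ ((Fintype.card F ^ P.natDegree - 1) / d) :=
    ⟨Units.mk0 _ (pow_ne_zero _ hres), hkey⟩
  rw [primeResSymbol, dif_pos hex]
  exact (AdjoinRoot.of P).injective (hex.choose_spec.trans hkey.symm)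

theorem coe_prod_primeResSymbol {F : Type} [Field F] [Fintype F] {d : ℕ}
    (hdvd : d ∣ Fintype.card F - 1) (a : F[X]) (s : Multiset F[X])
    (hs : ∀ P ∈ s, P.Monic ∧ Irreducible P ∧ IsCoprime P a) :
    ((s.map fun P => primeResSymbol d P a).prod : F) =
      resultant s.prod a ^ ((Fintype.card F - 1) / d) := by
  induction s using Multiset.induction_on with
  | empty => simp
  | cons P s ih =>
    obtain ⟨hP, hirr, hPa⟩ := hs P (Multiset.mem_cons_self P s)
    have hs' : ∀ Q ∈ s, Q.Monic ∧ Irreducible Q ∧ IsCoprime Q a :=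
      fun Q hQ => hs Q (Multiset.mem_cons_of_mem hQ)
    have hmonic : s.prod.Monic := by
      simpa using monic_multiset_prod_of_monic s id fun Q hQ => (hs' Q hQ).1
    rw [Multiset.map_cons, Multiset.prod_cons, Multiset.prod_cons, Units.val_mul, ih hs',
      coe_primeResSymbol hdvd hP hirr hPa, hP.natDegree_mul hmonic,
      resultant_mul_left P s.prod a _ le_rfl, mul_pow]

/-- The residue symbol `(a/b)_d` is the `(q - 1) / d`-th power of the resultant of `b` and `a`. -/
theorem coe_resSymbol {F : Type} [Field F] [Fintype F] {d : ℕ}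
    (hdvd : d ∣ Fintype.card F - 1) {a b : F[X]} (hb : b.Monic) (hba : IsCoprime b a) :
    (resSymbol d a b : F) = resultant b a ^ ((Fintype.card F - 1) / d) := by
  have hprod : (UniqueFactorizationMonoid.normalizedFactors b).prod = b := by
    rw [UniqueFactorizationMonoid.prod_normalizedFactors_eq hb.ne_zero, hb.normalize_eq_self]
  have hsymbol : resSymbol d a b =
      ((UniqueFactorizationMonoid.normalizedFactors b).map fun P => primeResSymbol d P a).prod := by
    rw [resSymbol, UniqueFactorizationMonoid.normalizedFactors, Multiset.map_map]
    exact congrArg Multiset.prod (Multiset.map_congr rfl fun P _ =>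
      primeResSymbol_eq_of_associated d (associated_normalize P) a)
  rw [hsymbol, coe_prod_primeResSymbol hdvd, hprod]
  intro P hP
  have hirr := UniqueFactorizationMonoid.irreducible_of_normalized_factor P hP
  refine ⟨?_, hirr, hba.of_isCoprime_of_dvd_left
    (UniqueFactorizationMonoid.dvd_of_mem_normalizedFactors hP)⟩
  rw [← UniqueFactorizationMonoid.normalize_normalized_factor P hP]
  exact monic_normalize hirr.ne_zero

theorem stmt16 (F : Type) [Field F] [Fintype F] (d : ℕ) (hd : 0 < d)
    (hdvd : d ∣ Fintype.card F - 1) (a b : Polynomial F)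
    (ha : a.Monic) (hb : b.Monic) (hab : IsCoprime a b) :
    resSymbol d a b = resSymbol d b a *
      (-1 : Fˣ) ^ (((Fintype.card F - 1) / d) * a.natDegree * b.natDegree) := by
  ext
  rw [Units.val_mul, Units.val_pow_eq_pow_val, Units.val_neg, Units.val_one,
    coe_resSymbol hdvd hb hab.symm, coe_resSymbol hdvd ha hab, resultant_comm b a, mul_pow,
    ← pow_mul]
  ring
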